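/- arXiv:2512.14519 — 12 statements merged into one kernel-verified Lean document; each statement's English description precedes it below -/
import Mathlib

section
/- Let R be a commutative ring with identity, S a multiplicatively closed subset of R, P an ideal of R, and let Q₁, …, Qₙ be finitely many P-S-primary ideals of R (each with radical P). Then the intersection Q₁ ∩ ⋯ ∩ Qₙ is a P-S-primary ideal of R. -/
variable {R : Type*}

/-- A proper ideal `Q` disjoint from `S` is `S`-primary if there is `s ∈ S` such that
for all `a b`, `a * b ∈ Q` implies `s * a ∈ Q` or `s * b ∈ Q.radical`. -/
def IsSPrimary [CommRing R] (S : Submonoid R) (Q : Ideal R) : Prop :=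
  Q ≠ ⊤ ∧ Disjoint (S : Set R) (Q : Set R) ∧
    ∃ s ∈ S, ∀ a b : R, a * b ∈ Q → s * a ∈ Q ∨ s * b ∈ Q.radical

/-- An ideal is `S`-decomposable if it is a finite intersection of `S`-primary ideals. -/
def IsSDecomposable [CommRing R] (S : Submonoid R) (I : Ideal R) : Prop :=
  ∃ (n : ℕ) (Q : Fin n → Ideal R), 0 < n ∧ (∀ i, IsSPrimary S (Q i)) ∧ I = ⨅ i, Q i

/-- A ring is nonnil-`S`-Laskerian if every nonnil ideal disjoint from `S`
is `S`-decomposable. -/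
def NonnilSLaskerian [CommRing R] (S : Submonoid R) : Prop :=
  ∀ I : Ideal R, ¬ I ≤ nilradical R → Disjoint (S : Set R) (I : Set R) →
    IsSDecomposable S I

/-- A ring is `S`-Laskerian if every proper ideal disjoint from `S` is `S`-decomposable. -/
def SLaskerian [CommRing R] (S : Submonoid R) : Prop :=
  ∀ I : Ideal R, I ≠ ⊤ → Disjoint (S : Set R) (I : Set R) → IsSDecomposable S I

/-- An ideal `I` is `S`-finite if `s • I ⊆ J ⊆ I` for some `s ∈ S` and finitely
generated ideal `J`. -/
def IsSFinite [CommRing R] (S : Submonoid R) (I : Ideal R) : Prop :=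
  ∃ s ∈ S, ∃ J : Ideal R, J.FG ∧ J ≤ I ∧ ∀ x ∈ I, s * x ∈ J

/-- A ring is nonnil-`S`-Noetherian if every nonnil ideal is `S`-finite. -/
def NonnilSNoetherian [CommRing R] (S : Submonoid R) : Prop :=
  ∀ I : Ideal R, ¬ I ≤ nilradical R → IsSFinite S I

/-- A finite intersection of `P`-`S`-primary ideals is `P`-`S`-primary. -/
theorem finite_inter_SPrimary {R : Type*} [CommRing R] (S : Submonoid R) (P : Ideal R)
    (n : ℕ) (hn : 0 < n) (Q : Fin n → Ideal R)
    (hprim : ∀ i, IsSPrimary S (Q i)) (hrad : ∀ i, (Q i).radical = P) :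
    IsSPrimary S (⨅ i, Q i) ∧ (⨅ i, Q i).radical = P := by
  have hR : (⨅ i, Q i).radical = P := by
    rw [← hrad ⟨0, hn⟩, ← Finset.inf_univ_eq_iInf]
    exact Ideal.radical_finset_inf (Finset.mem_univ _) fun y _ => by rw [hrad, hrad]
  have hle : (⨅ i, Q i) ≤ Q ⟨0, hn⟩ := iInf_le _ _
  refine ⟨⟨ne_top_of_le_ne_top (hprim ⟨0, hn⟩).1 hle, (hprim ⟨0, hn⟩).2.1.mono_right hle, ?_⟩, hR⟩
  choose s hs h using fun i => (hprim i).2.2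
  have key (i : Fin n) {I : Ideal R} {x : R} (hx : s i * x ∈ I) : (∏ j, s j) * x ∈ I :=
    I.mem_of_dvd (mul_dvd_mul_right (Finset.dvd_prod_of_mem s (Finset.mem_univ i)) x) hx
  refine ⟨∏ i, s i, S.prod_mem fun i _ => hs i, fun a b hab => ?_⟩
  rw [hR]
  by_cases hb : ∃ i, s i * b ∈ P
  · obtain ⟨i, hi⟩ := hb
    exact Or.inr (key i hi)
  · push Not at hb
    refine Or.inl ((Submodule.mem_iInf _).2 fun i => key i ?_)
    exact (h i a b ((Submodule.mem_iInf _).1 hab i)).resolve_right (hrad i ▸ hb i)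
end

section
/- Let R be a commutative ring with identity and S a multiplicatively closed subset of R. If Q is a P-primary ideal of R with Q ∩ S = ∅ and J is an ideal of R with J ∩ S ≠ ∅, then Q ∩ J is a (P ∩ rad(J))-S-primary ideal of R. -/
variable {R : Type*}

/-- If `Q` is a `P`-primary ideal disjoint from `S` and `J` is an ideal meeting `S`,
then `Q ⊓ J` is a `(P ⊓ rad J)`-`S`-primary ideal. -/
theorem primary_inter_SPrimary {R : Type*} [CommRing R] (S : Submonoid R)
    (Q P J : Ideal R) (hQ : Q.IsPrimary) (hQP : Q.radical = P)
    (hQS : Disjoint (S : Set R) (Q : Set R))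
    (hJS : ((S : Set R) ∩ (J : Set R)).Nonempty) :
    IsSPrimary S (Q ⊓ J) ∧ (Q ⊓ J).radical = P ⊓ J.radical := by
  obtain ⟨s, hsS, hsJ⟩ := hJS
  have hrad : (Q ⊓ J).radical = Q.radical ⊓ J.radical := Ideal.radical_inf Q J
  refine ⟨⟨?_, hQS.mono_right fun _ hx => hx.1, s, hsS, fun a b hab => ?_⟩, hQP ▸ hrad⟩
  · exact fun h => hQ.ne_top (top_le_iff.mp (h ▸ inf_le_left))
  · rw [hrad]
    exact ((Ideal.isPrimary_iff.mp hQ).2 hab.1).imp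
      (fun ha => ⟨Q.mul_mem_left s ha, J.mul_mem_right a hsJ⟩)
      (fun hb => ⟨Q.radical.mul_mem_left s hb,
        J.radical.mul_mem_right b (Ideal.le_radical hsJ)⟩)
end

section
/- Let R be a commutative ring with identity, S a multiplicatively closed subset of R, and I an ideal of R with I ∩ S = ∅. If I admits an S-primary decomposition, then I admits a minimal S-primary decomposition, i.e., I = Q'₁ ∩ ⋯ ∩ Q'ₖ with each Q'ₜ an S-primary ideal with radical P'ₜ, such that S(P'ᵢ) ≠ S(P'ⱼ) for all distinct i, j, and for each i, S(Q'ᵢ) does not contain the intersection of the S(Q'ⱼ) over j ≠ i. -/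
variable {R : Type*}

/-- The contraction `S(I)` of an ideal `I`: the preimage of `S⁻¹I` in `R`. -/
noncomputable def sCon [CommRing R] (S : Submonoid R) (I : Ideal R) : Ideal R :=
  (I.map (algebraMap R (Localization S))).comap (algebraMap R (Localization S))

theorem mem_sCon {R : Type*} [CommRing R] {S : Submonoid R} {I : Ideal R} {x : R} :
    x ∈ sCon S I ↔ ∃ m ∈ S, m * x ∈ I := by
  rw [sCon, Ideal.mem_comap, IsLocalization.algebraMap_mem_map_algebraMap_iff S]

theorem le_sCon {R : Type*} [CommRing R] (S : Submonoid R) (I : Ideal R) : I ≤ sCon S I :=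
  Ideal.le_comap_map

theorem sCon_radical {R : Type*} [CommRing R] (S : Submonoid R) (I : Ideal R) :
    sCon S I.radical = (sCon S I).radical := by
  ext x
  rw [mem_sCon]
  constructor
  · rintro ⟨m, hm, n, hn⟩
    exact ⟨n, mem_sCon.2 ⟨m ^ n, pow_mem hm n, mul_pow m x n ▸ hn⟩⟩
  · rintro ⟨n, hn⟩
    obtain ⟨m, hm, h⟩ := mem_sCon.1 hn
    refine ⟨m, hm, n + 1, ?_⟩
    have : (m * x) ^ (n + 1) = m ^ n * x * (m * x ^ n) := by ring
    exact this ▸ I.mul_mem_left _ h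

/-- The contraction of an `S`-primary ideal `Q` is the colon ideal `(Q : s)` for some `s ∈ S`. -/
theorem IsSPrimary.exists_mul_mem {R : Type*} [CommRing R] {S : Submonoid R} {Q : Ideal R}
    (hQ : IsSPrimary S Q) : ∃ s ∈ S, ∀ x ∈ sCon S Q, s * x ∈ Q := by
  obtain ⟨-, hdisj, s, hs, h⟩ := hQ
  refine ⟨s, hs, fun x hx ↦ ?_⟩
  obtain ⟨m, hm, hmx⟩ := mem_sCon.1 hx
  refine (h x m (mul_comm m x ▸ hmx)).resolve_right ?_
  rintro ⟨n, hn⟩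
  exact Set.disjoint_left.1 hdisj (pow_mem (mul_mem hs hm) n) hn

theorem IsSPrimary.isPrimary_sCon {R : Type*} [CommRing R] {S : Submonoid R} {Q : Ideal R}
    (hQ : IsSPrimary S Q) : (sCon S Q).IsPrimary := by
  obtain ⟨-, hdisj, s, hs, h⟩ := hQ
  refine Ideal.isPrimary_iff.2 ⟨fun htop ↦ ?_, fun {x y} hxy ↦ ?_⟩
  · obtain ⟨m, hm, h1⟩ := mem_sCon.1 ((Ideal.eq_top_iff_one _).1 htop)
    exact Set.disjoint_left.1 hdisj hm (mul_one m ▸ h1)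
  · obtain ⟨m, hm, hmxy⟩ := mem_sCon.1 hxy
    rcases h (m * x) y (by rwa [mul_assoc]) with h | h
    · exact .inl (mem_sCon.2 ⟨s * m, mul_mem hs hm, by rwa [mul_assoc]⟩)
    · exact .inr (sCon_radical S Q ▸ mem_sCon.2 ⟨s, hs, h⟩)

theorem exists_mul_mem_iInf {R ι : Type*} [CommRing R] [Fintype ι] {S : Submonoid R}
    {Q : ι → Ideal R} (hQ : ∀ i, IsSPrimary S (Q i)) :
    ∃ s ∈ S, ∀ x ∈ ⨅ i, sCon S (Q i), s * x ∈ ⨅ i, Q i := by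
  choose s hs h using fun i ↦ (hQ i).exists_mul_mem
  refine ⟨∏ i, s i, prod_mem fun i _ ↦ hs i, fun x hx ↦ ?_⟩
  rw [Submodule.mem_iInf] at hx ⊢
  intro i
  obtain ⟨c, hc⟩ := Finset.dvd_prod_of_mem s (Finset.mem_univ i)
  rw [hc, mul_comm (s i), mul_assoc]
  exact (Q i).mul_mem_left c (h i x (hx i))

/-- A primary ideal disjoint from `S` is its own contraction. -/
theorem Ideal.IsPrimary.mem_of_mul_mem {R : Type*} [CommRing R] {S : Submonoid R} {J : Ideal R}
    (hJ : J.IsPrimary) (hdisj : Disjoint (S : Set R) (J : Set R)) {m x : R} (hm : m ∈ S)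
    (h : m * x ∈ J) : x ∈ J := by
  refine ((Ideal.isPrimary_iff.1 hJ).2 (mul_comm m x ▸ h)).resolve_right ?_
  rintro ⟨n, hn⟩
  exact Set.disjoint_left.1 hdisj (pow_mem hm n) hn

theorem sCon_inf_eq_of_isPrimary {R : Type*} [CommRing R] {S : Submonoid R} {J K : Ideal R}
    (hJ : J.IsPrimary) (hdisj : Disjoint (S : Set R) (J : Set R)) {s : R} (hs : s ∈ S)
    (hsK : s ∈ K) : sCon S (J ⊓ K) = J := by
  ext x
  rw [mem_sCon]
  constructor
  · rintro ⟨m, hm, h⟩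
    exact hJ.mem_of_mul_mem hdisj hm h.1
  · exact fun hx ↦ ⟨s, hs, J.mul_mem_left s hx, K.mul_mem_right x hsK⟩

theorem isSPrimary_inf_of_isPrimary {R : Type*} [CommRing R] {S : Submonoid R} {J K : Ideal R}
    (hJ : J.IsPrimary) (hdisj : Disjoint (S : Set R) (J : Set R)) {s : R} (hs : s ∈ S)
    (hsK : s ∈ K) : IsSPrimary S (J ⊓ K) := by
  have hJ' := Ideal.isPrimary_iff.1 hJ
  refine ⟨fun h ↦ hJ'.1 (top_le_iff.1 (h ▸ inf_le_left)), hdisj.mono_right fun x hx ↦ hx.1,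
    s, hs, fun a b hab ↦ (hJ'.2 hab.1).imp (fun ha ↦ ⟨J.mul_mem_left s ha, K.mul_mem_right a hsK⟩)
      fun hb ↦ ?_⟩
  rw [Ideal.radical_inf]
  exact ⟨Ideal.mul_mem_left _ s hb, Ideal.mul_mem_right b _ (Ideal.le_radical hsK)⟩

/-- If `s ∈ S` carries `S(I)` into `I`, then `I = S(I) ∩ (I + sR)`. -/
theorem sCon_inf_sup_span_eq {R : Type*} [CommRing R] {S : Submonoid R} {I : Ideal R} {s : R}
    (hs : s ∈ S) (h : ∀ x ∈ sCon S I, s * x ∈ I) : sCon S I ⊓ (I ⊔ Ideal.span {s}) = I := by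
  refine le_antisymm ?_ (le_inf (le_sCon S I) le_sup_left)
  rintro x ⟨hx, hx'⟩
  obtain ⟨i, hi, y, hy, rfl⟩ := Submodule.mem_sup.1 hx'
  obtain ⟨r, rfl⟩ := Ideal.mem_span_singleton'.1 hy
  have hrs : r * s ∈ sCon S I := (Ideal.add_mem_iff_right _ (le_sCon S I hi)).1 hx
  obtain ⟨m, hm, hmr⟩ := mem_sCon.1 hrs
  have hr : r ∈ sCon S I := mem_sCon.2 ⟨m * s, mul_mem hm hs, by
    rwa [mul_assoc, mul_comm s r]⟩
  exact I.add_mem hi (mul_comm s r ▸ h r hr)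

/-- The components of an irredundant decomposition of an `S`-saturated ideal are disjoint
from `S`. -/
theorem disjoint_of_not_inf_erase_le {R : Type*} [CommRing R] [DecidableEq (Ideal R)]
    {S : Submonoid R} {I : Ideal R} {t : Finset (Ideal R)} (ht : t.inf id = sCon S I)
    {J : Ideal R} (hJ : J ∈ t) (hmin : ¬ (t.erase J).inf id ≤ J) :
    Disjoint (S : Set R) (J : Set R) := by
  refine Set.disjoint_left.2 fun u hu huJ ↦ hmin fun x hx ↦ ?_
  have hux : u * x ∈ sCon S I := by
    rw [← ht, ← Finset.insert_erase hJ, Finset.inf_insert]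
    exact ⟨J.mul_mem_right x huJ, Ideal.mul_mem_left _ u hx⟩
  obtain ⟨m, hm, h⟩ := mem_sCon.1 hux
  have hx' : x ∈ sCon S I := mem_sCon.2 ⟨m * u, mul_mem hm hu, by rwa [mul_assoc]⟩
  rw [← ht] at hx'
  exact Finset.inf_le (f := id) hJ hx'

/-- If an ideal disjoint from `S` admits an `S`-primary decomposition, then it admits a
minimal `S`-primary decomposition. -/
theorem exists_minimal_SPrimary_decomposition {R : Type*} [CommRing R] (S : Submonoid R)
    (I : Ideal R) (hIS : Disjoint (S : Set R) (I : Set R))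
    (hdec : IsSDecomposable S I) :
    ∃ (k : ℕ) (Q : Fin k → Ideal R), 0 < k ∧ (∀ t, IsSPrimary S (Q t)) ∧
      I = ⨅ t, Q t ∧
      (∀ i j, i ≠ j → sCon S ((Q i).radical) ≠ sCon S ((Q j).radical)) ∧
      (∀ i, ¬ (⨅ j, ⨅ _ : j ≠ i, sCon S (Q j)) ≤ sCon S (Q i)) := by
  classical
  obtain ⟨n, Q, -, hQ, hI⟩ := hdec
  obtain ⟨s, hs, hsQ⟩ := exists_mul_mem_iInf hQ
  rw [← hI] at hsQ
  have hSI : ⨅ i, sCon S (Q i) = sCon S I := by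
    refine le_antisymm (fun x hx ↦ mem_sCon.2 ⟨s, hs, hsQ x hx⟩) (le_iInf fun i ↦ ?_)
    exact Ideal.comap_mono (Ideal.map_mono (hI ▸ iInf_le Q i))
  rw [hSI] at hsQ
  obtain ⟨t, ht, hprim, hrad, hmin⟩ :=
    Submodule.exists_minimal_isPrimary_decomposition_of_isPrimary_decomposition
      (N := sCon S I) (s := Finset.univ.image fun i ↦ sCon S (Q i))
      (by rw [← hSI, Finset.inf_image, Function.id_comp, Finset.inf_univ_eq_iInf])
      (by
        intro J hJ
        obtain ⟨i, -, rfl⟩ := Finset.mem_image.1 hJ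
        exact (hQ i).isPrimary_sCon)
  have hdisj : ∀ J ∈ t, Disjoint (S : Set R) (J : Set R) := fun J hJ ↦
    disjoint_of_not_inf_erase_le ht hJ (hmin hJ)
  have hne : t.Nonempty := by
    rw [Finset.nonempty_iff_ne_empty]
    rintro rfl
    obtain ⟨m, hm, h1⟩ := mem_sCon.1 (ht ▸ Submodule.mem_top : (1 : R) ∈ sCon S I)
    exact Set.disjoint_left.1 hIS hm (mul_one m ▸ h1)
  let K : Ideal R := I ⊔ Ideal.span {s}
  have hsK : s ∈ K := Ideal.mem_sup_right (Ideal.mem_span_singleton_self s)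
  let e := t.equivFin.symm
  have hcon : ∀ i, sCon S ((e i : Ideal R) ⊓ K) = e i := fun i ↦
    sCon_inf_eq_of_isPrimary (hprim (e i).2) (hdisj _ (e i).2) hs hsK
  have hcard : 0 < t.card := hne.card_pos
  have : Nonempty (Fin t.card) := ⟨⟨0, hcard⟩⟩
  refine ⟨t.card, fun i ↦ (e i : Ideal R) ⊓ K, hcard, fun i ↦
    isSPrimary_inf_of_isPrimary (hprim (e i).2) (hdisj _ (e i).2) hs hsK, ?_, ?_, ?_⟩
  · rw [← iInf_inf, e.iInf_comp (g := fun J : t ↦ (J : Ideal R)), iInf_subtype,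
      ← Finset.inf_eq_iInf t fun J ↦ J]
    exact (ht ▸ sCon_inf_sup_span_eq hs hsQ).symm
  · intro i j hij
    have hij' : (e i : Ideal R) ≠ e j := fun h ↦ hij (e.injective (Subtype.ext h))
    rw [sCon_radical, sCon_radical, hcon, hcon]
    simpa [Function.onFun] using hrad (e i).2 (e j).2 hij'
  · intro i hle
    simp only [hcon] at hle
    refine hmin (e i).2 (le_trans (le_iInf₂ fun j hj ↦ ?_) hle)
    exact Finset.inf_le (f := id) (Finset.mem_erase.2
      ⟨fun h ↦ hj (e.injective (Subtype.ext h)), (e j).2⟩)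
end

section
/- Let R be a commutative ring with identity, S a multiplicatively closed subset of R, and I an ideal of R contained in Nil(R). If R is a nonnil-S-Laskerian ring, then the quotient ring R/I is nonnil-S̄-Laskerian, where S̄ = {s + I : s ∈ S} is the image of S in R/I. (In particular, Nil(R/I) = Nil(R)/I.) -/
variable {R : Type*}

/-- An ideal whose preimage under a surjective ring homomorphism is `S`-primary is primary
with respect to the image of `S`. -/
theorem IsSPrimary.of_comap {A B : Type*} [CommRing A] [CommRing B] {f : A →+* B}
    (hf : Function.Surjective f) {S : Submonoid A} {P : Ideal B}
    (hP : IsSPrimary S (P.comap f)) : IsSPrimary (S.map f.toMonoidHom) P := by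
  obtain ⟨hne, hdisj, s, hs, hprim⟩ := hP
  refine ⟨fun hP ↦ hne (by rw [hP, Ideal.comap_top]), ?_, f s, ⟨s, hs, rfl⟩, ?_⟩
  · rw [Set.disjoint_left] at hdisj ⊢
    rintro _ ⟨t, ht, rfl⟩ htP
    exact hdisj ht htP
  · intro a b hab
    obtain ⟨a, rfl⟩ := hf a
    obtain ⟨b, rfl⟩ := hf b
    rw [← map_mul, ← map_mul]
    rw [← map_mul] at hab
    simpa only [← Ideal.comap_radical, Ideal.mem_comap] using hprim a b hab

/-- An ideal whose preimage under a surjective ring homomorphism is `S`-decomposable is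
decomposable with respect to the image of `S`. -/
theorem IsSDecomposable.of_comap {A B : Type*} [CommRing A] [CommRing B] {f : A →+* B}
    (hf : Function.Surjective f) {S : Submonoid A} {J : Ideal B}
    (hJ : IsSDecomposable S (J.comap f)) : IsSDecomposable (S.map f.toMonoidHom) J := by
  obtain ⟨n, Q, hn, hQ, hJQ⟩ := hJ
  have hcomap (i : Fin n) : ((Q i).map f).comap f = Q i := by
    rw [Ideal.comap_map_of_surjective' f hf, sup_eq_left]
    exact (Ideal.ker_le_comap f).trans (hJQ.trans_le (iInf_le Q i))
  refine ⟨n, fun i ↦ (Q i).map f, hn, fun i ↦ .of_comap hf (by rw [hcomap]; exact hQ i), ?_⟩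
  apply Ideal.comap_injective_of_surjective f hf
  simp only [Ideal.comap_iInf, hcomap, hJQ]

/-- If `R` is nonnil-`S`-Laskerian and `I ⊆ Nil(R)`, then `R/I` is
nonnil-`S̄`-Laskerian, where `S̄` is the image of `S` in `R/I`; moreover
`Nil(R/I) = Nil(R)/I`. -/
theorem quotient_nonnilSLaskerian {R : Type*} [CommRing R] (S : Submonoid R)
    (I : Ideal R) (hI : I ≤ nilradical R) (h : NonnilSLaskerian S) :
    NonnilSLaskerian (S.map (Ideal.Quotient.mk I).toMonoidHom) ∧
      nilradical (R ⧸ I) = (nilradical R).map (Ideal.Quotient.mk I) := by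
  have hsurj := Ideal.Quotient.mk_surjective (I := I)
  have hnil : (nilradical (R ⧸ I)).comap (Ideal.Quotient.mk I) = nilradical R := by
    rw [nilradical, Ideal.comap_radical, Ideal.zero_eq_bot, ← RingHom.ker_eq_comap_bot,
      Ideal.mk_ker]
    exact le_antisymm (Ideal.radical_le_radical_iff.mpr hI) (Ideal.radical_mono bot_le)
  refine ⟨fun J hJ hdisj ↦ .of_comap hsurj (h _ ?_ ?_), ?_⟩
  · rwa [← hnil, Ideal.comap_le_comap_iff_of_surjective _ hsurj]
  · rw [Set.disjoint_left] at hdisj ⊢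
    exact fun s hs hsJ ↦ hdisj ⟨s, hs, rfl⟩ hsJ
  · rw [← hnil, Ideal.map_comap_of_surjective _ hsurj]
end

section
/- Let R be a commutative ring with identity and S a multiplicatively closed subset of R. If R is a nonnil-S-Laskerian ring, then the localization S⁻¹R is a nonnil-Laskerian ring, i.e., every nonnil proper ideal of S⁻¹R is a finite intersection of primary ideals of S⁻¹R. -/
variable {R : Type*}

/-- The extension of an `S`-primary ideal to a localization at `S` is primary. -/
theorem IsSPrimary.isPrimary_map {R : Type*} [CommRing R] {S : Submonoid R} (A : Type*)
    [CommRing A] [Algebra R A] [IsLocalization S A] {Q : Ideal R} (hQ : IsSPrimary S Q) :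
    (Q.map (algebraMap R A)).IsPrimary := by
  obtain ⟨-, hdisj, s, hs, hprim⟩ := hQ
  refine Ideal.isPrimary_iff.mpr
    ⟨(IsLocalization.map_algebraMap_ne_top_iff_disjoint S A Q).mpr hdisj, fun {x y} hxy ↦ ?_⟩
  obtain ⟨a, t, rfl⟩ := IsLocalization.exists_mk'_eq S x
  obtain ⟨b, v, rfl⟩ := IsLocalization.exists_mk'_eq S y
  rw [← IsLocalization.mk'_mul, IsLocalization.mk'_mem_map_algebraMap_iff] at hxy
  obtain ⟨u, hu, huab⟩ := hxy
  rw [← IsLocalization.map_radical S, IsLocalization.mk'_mem_map_algebraMap_iff,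
    IsLocalization.mk'_mem_map_algebraMap_iff]
  rcases hprim (u * a) b (by rwa [mul_assoc]) with ha | hb
  · exact .inl ⟨s * u, mul_mem hs hu, by rwa [mul_assoc]⟩
  · exact .inr ⟨s, hs, hb⟩

/-- An ideal of a localization whose contraction is nil is itself nil. -/
theorem IsLocalization.le_nilradical_of_under_le {R : Type*} [CommRing R] (S : Submonoid R)
    {A : Type*} [CommRing A] [Algebra R A] [IsLocalization S A] {J : Ideal A}
    (hJ : J.under R ≤ nilradical R) : J ≤ nilradical A := by
  rw [← IsLocalization.map_under S A J, Ideal.map_le_iff_le_comap]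
  exact fun a ha ↦ (mem_nilradical.mp (hJ ha)).map (algebraMap R A)

/-- If `R` is nonnil-`S`-Laskerian, then `S⁻¹R` is nonnil-Laskerian: every nonnil
proper ideal of `S⁻¹R` is a finite intersection of primary ideals. -/
theorem localization_nonnilLaskerian {R : Type*} [CommRing R] (S : Submonoid R)
    (h : NonnilSLaskerian S) :
    ∀ J : Ideal (Localization S), J ≠ ⊤ → ¬ J ≤ nilradical (Localization S) →
      ∃ (n : ℕ) (Q : Fin n → Ideal (Localization S)),
        0 < n ∧ (∀ i, (Q i).IsPrimary) ∧ J = ⨅ i, Q i := by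
  intro J hJ hnil
  obtain ⟨n, Q, hn, hQ, hJQ⟩ := h (J.under R)
    (fun hle ↦ hnil (IsLocalization.le_nilradical_of_under_le S hle))
    ((IsLocalization.map_algebraMap_ne_top_iff_disjoint S (Localization S) _).mp
      (by rwa [IsLocalization.map_under S]))
  refine ⟨n, fun i ↦ (Q i).map (algebraMap R (Localization S)), hn,
    fun i ↦ (hQ i).isPrimary_map _, ?_⟩
  rw [← IsLocalization.map_under S (Localization S) J, hJQ, ← Finset.inf_univ_eq_iInf,
    ← Finset.inf_univ_eq_iInf]
  exact map_finset_inf (IsLocalization.mapFrameHom S (Localization S)) _ _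
end

section
/- Let R be a commutative ring with identity and S a multiplicatively closed subset of R such that the nilradical Nil(R) is a divided ideal (i.e., Nil(R) ⊂ (a) for every a ∈ R ∖ Nil(R)). If R/Nil(R) is an S̄-Laskerian ring, where S̄ = {s + Nil(R) : s ∈ S}, then R is a nonnil-S-Laskerian ring. -/
variable {R : Type*}

/-- The preimage of an `S`-primary ideal under a ring homomorphism is `S`-primary. -/
theorem IsSPrimary.comap {R A : Type*} [CommRing R] [CommRing A] {S : Submonoid R}
    (f : R →+* A) {Q : Ideal A} (hQ : IsSPrimary (S.map f.toMonoidHom) Q) :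
    IsSPrimary S (Q.comap f) := by
  obtain ⟨hne, hdisj, t, ht, hprim⟩ := hQ
  obtain ⟨s, hs, rfl⟩ := Submonoid.mem_map.mp ht
  refine ⟨Ideal.comap_ne_top f hne, Set.disjoint_left.mpr fun x hx hxQ =>
    Set.disjoint_left.mp hdisj (Submonoid.mem_map_of_mem f.toMonoidHom hx) hxQ,
    s, hs, fun a b hab => ?_⟩
  rw [← Ideal.comap_radical, Ideal.mem_comap, Ideal.mem_comap, map_mul, map_mul]
  exact hprim (f a) (f b) (by rwa [Ideal.mem_comap, map_mul] at hab)

/-- The preimage of an `S`-decomposable ideal under a ring homomorphism is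
`S`-decomposable. -/
theorem IsSDecomposable.comap {R A : Type*} [CommRing R] [CommRing A] {S : Submonoid R}
    (f : R →+* A) {I : Ideal A} (hI : IsSDecomposable (S.map f.toMonoidHom) I) :
    IsSDecomposable S (I.comap f) := by
  obtain ⟨n, Q, hn, hQ, rfl⟩ := hI
  exact ⟨n, fun i => (Q i).comap f, hn, fun i => (hQ i).comap f, Ideal.comap_iInf ..⟩

/-- If `Nil(R)` is a divided ideal and `R/Nil(R)` is `S̄`-Laskerian, then `R` is
nonnil-`S`-Laskerian. -/
theorem nonnilSLaskerian_of_quotient {R : Type*} [CommRing R] (S : Submonoid R)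
    (hdiv : ∀ a : R, a ∉ nilradical R → nilradical R < Ideal.span {a})
    (h : SLaskerian (S.map (Ideal.Quotient.mk (nilradical R)).toMonoidHom)) :
    NonnilSLaskerian S := by
  intro I hnonnil hdisj
  obtain ⟨a, haI, ha⟩ := SetLike.not_le_iff_exists.mp hnonnil
  have hle : nilradical R ≤ I :=
    (hdiv a ha).le.trans ((Ideal.span_singleton_le_iff_mem I).mpr haI)
  have hcomap : (I.map (Ideal.Quotient.mk (nilradical R))).comap
      (Ideal.Quotient.mk (nilradical R)) = I := by
    rw [Ideal.comap_map_of_surjective' _ Ideal.Quotient.mk_surjective, Ideal.mk_ker,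
      sup_eq_left.mpr hle]
  have hdisj' : Disjoint
      (S.map (Ideal.Quotient.mk (nilradical R)).toMonoidHom : Set (R ⧸ nilradical R))
      (I.map (Ideal.Quotient.mk (nilradical R)) : Set (R ⧸ nilradical R)) := by
    rw [Set.disjoint_left]
    rintro _ ⟨s, hs, rfl⟩ hsI
    exact Set.disjoint_left.mp hdisj hs (hcomap.le hsI)
  rw [← hcomap]
  refine (h _ (fun htop => ?_) hdisj').comap _
  exact Set.disjoint_left.mp hdisj' (one_mem (S.map _)) (htop ▸ Submodule.mem_top)
end

section
/- Let R be a commutative ring with identity and S a multiplicatively closed subset of R such that Nil(R) is a prime divided ideal disjoint from S. Let I be a nil ideal of R (i.e., I ⊆ Nil(R)). Then I is S-decomposable if and only if I is S-primary. -/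
variable {R : Type*}

/-- If `Nil(R)` is a prime divided ideal disjoint from `S` and `I` is a nil ideal,
then `I` is `S`-decomposable iff `I` is `S`-primary. -/
theorem nil_SDecomposable_iff_SPrimary {R : Type*} [CommRing R] (S : Submonoid R)
    (hprime : (nilradical R).IsPrime)
    (hdiv : ∀ a : R, a ∉ nilradical R → nilradical R < Ideal.span {a})
    (hdisj : Disjoint (S : Set R) (nilradical R : Set R))
    (I : Ideal R) (hI : I ≤ nilradical R) :
    IsSDecomposable S I ↔ IsSPrimary S I := by
  refine ⟨?_, fun h => ⟨1, fun _ => I, one_pos, fun _ => h, ciInf_const.symm⟩⟩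
  rintro ⟨n, Q, -, hQ, rfl⟩
  refine ⟨fun h => hprime.ne_top (top_le_iff.mp (h ▸ hI)), hdisj.mono_right hI, ?_⟩
  choose s hs hsQ using fun i => (hQ i).2.2
  refine ⟨∏ i, s i, S.prod_mem fun i _ => hs i, fun a b hab => ?_⟩
  by_cases hb : b ∈ nilradical R
  · exact .inr (Ideal.mul_mem_left _ _ (Ideal.radical_mono bot_le hb))
  have ha : a ∈ nilradical R := (hprime.mem_or_mem (hI hab)).resolve_right hb
  refine .inl (Ideal.mem_iInf.mpr fun i => ?_)
  by_cases hi : Q i ≤ nilradical R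
  · obtain h | h := hsQ i a b (Ideal.mem_iInf.mp hab i)
    · exact Ideal.mem_of_dvd _ (mul_dvd_mul_right (Finset.dvd_prod_of_mem s (Finset.mem_univ i)) a) h
    · obtain h | h := hprime.mem_or_mem (hprime.radical_le_iff.mpr hi h)
      · exact absurd h (Set.disjoint_left.mp hdisj (hs i))
      · exact absurd h hb
  · obtain ⟨c, hcQ, hc⟩ := SetLike.not_le_iff_exists.mp hi
    exact Ideal.mul_mem_left _ _
      ((Ideal.span_singleton_le_iff_mem _).mpr hcQ ((hdiv c hc).le ha))
end

section
/- Let R be a commutative ring with identity and S a multiplicatively closed subset of R such that Nil(R) is a prime divided ideal disjoint from S. Then R is S-Laskerian if and only if R is nonnil-S-Laskerian and every ideal contained in Nil(R) is a Nil(R)-S-primary ideal. -/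
variable {R : Type*}

/-- An ideal contained in the nilradical has its radical contained in the nilradical. -/
theorem radical_le_nilradical [CommRing R] {I : Ideal R} (hI : I ≤ nilradical R) :
    I.radical ≤ nilradical R :=
  (Ideal.radical_isRadical _).radical_le_iff.mpr hI

theorem radical_eq_nilradical [CommRing R] {I : Ideal R} (hI : I ≤ nilradical R) :
    I.radical = nilradical R :=
  le_antisymm (radical_le_nilradical hI) (Ideal.radical_mono bot_le)

/-- An `S`-primary ideal is `S`-decomposable. -/
theorem IsSPrimary.isSDecomposable [CommRing R] {S : Submonoid R} {I : Ideal R}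
    (hI : IsSPrimary S I) : IsSDecomposable S I :=
  ⟨1, fun _ => I, one_pos, fun _ => hI, by simp⟩

/-- If `Nil(R)` is a divided prime disjoint from `S`, then an `S`-decomposable ideal contained in
`Nil(R)` is `S`-primary. -/
theorem IsSDecomposable.isSPrimary_of_le_nilradical [CommRing R] {S : Submonoid R}
    (hprime : (nilradical R).IsPrime)
    (hdiv : ∀ a : R, a ∉ nilradical R → nilradical R < Ideal.span {a})
    (hdisj : Disjoint (S : Set R) (nilradical R : Set R)) {I : Ideal R}
    (hI : I ≤ nilradical R) (hdec : IsSDecomposable S I) : IsSPrimary S I := by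
  obtain ⟨n, Q, -, hQ, hIQ⟩ := hdec
  choose _ _ s hs hsQ using hQ
  refine ⟨fun h => hprime.ne_top (top_le_iff.mp (h ▸ hI)), hdisj.mono_right hI,
    ∏ i, s i, S.prod_mem fun i _ => hs i, fun a b hab => ?_⟩
  by_cases hb : b ∈ nilradical R
  · right
    rw [radical_eq_nilradical hI]
    exact Ideal.mul_mem_left _ _ hb
  left
  have ha : a ∈ nilradical R := (hprime.mem_or_mem (hI hab)).resolve_right hb
  rw [hIQ, Ideal.mem_iInf] at hab ⊢
  intro i
  by_cases hi : Q i ≤ nilradical R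
  · obtain h | h := hsQ i a b (hab i)
    · obtain ⟨c, hc⟩ := Finset.dvd_prod_of_mem s (Finset.mem_univ i)
      rw [hc, mul_comm (s i) c, mul_assoc]
      exact Ideal.mul_mem_left _ _ h
    · obtain h | h := hprime.mem_or_mem (radical_le_nilradical hi h)
      · exact absurd h (Set.disjoint_left.mp hdisj (hs i))
      · exact absurd h hb
  · obtain ⟨c, hcQ, hc⟩ := SetLike.not_le_iff_exists.mp hi
    exact Ideal.mul_mem_left _ _
      ((Ideal.span_singleton_le_iff_mem _).mpr hcQ ((hdiv c hc).le ha))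

/-- If `Nil(R)` is a prime divided ideal disjoint from `S`, then `R` is `S`-Laskerian
iff `R` is nonnil-`S`-Laskerian and every ideal contained in `Nil(R)` is
`Nil(R)`-`S`-primary. -/
theorem SLaskerian_iff_nonnilSLaskerian {R : Type*} [CommRing R] (S : Submonoid R)
    (hprime : (nilradical R).IsPrime)
    (hdiv : ∀ a : R, a ∉ nilradical R → nilradical R < Ideal.span {a})
    (hdisj : Disjoint (S : Set R) (nilradical R : Set R)) :
    SLaskerian S ↔ (NonnilSLaskerian S ∧
      ∀ I : Ideal R, I ≤ nilradical R → IsSPrimary S I ∧ I.radical = nilradical R) := by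
  constructor
  · intro h
    refine ⟨fun I hI hIS => h I (fun htop => ?_) hIS, fun I hI => ⟨?_, radical_eq_nilradical hI⟩⟩
    · exact Set.disjoint_left.mp hIS S.one_mem (htop ▸ Submodule.mem_top)
    · exact (h I (fun htop => hprime.ne_top (top_le_iff.mp (htop ▸ hI)))
        (hdisj.mono_right hI)).isSPrimary_of_le_nilradical hprime hdiv hdisj hI
  · rintro ⟨hnonnil, hnil⟩ I - hIS
    by_cases hI : I ≤ nilradical R
    · exact (hnil I hI).1.isSDecomposable
    · exact hnonnil I hI hIS
end

section
/- Let R be a commutative ring with identity and S a multiplicatively closed subset of R. If R is a nonnil-S-Laskerian ring whose nilradical Nil(R) is S-decomposable, then every prime ideal P of R is radically S-finite, i.e., there exist s ∈ S and a finitely generated ideal J of R such that sP ⊆ rad(J) ⊆ rad(P); hence R has S-Noetherian spectrum. -/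
variable {R : Type*}

/-- An `S`-decomposable ideal `I` is contained in finitely many primes disjoint from `S` whose
intersection is multiplied into the radical of `I` by a single element of `S`. -/
theorem IsSDecomposable.exists_primes {R : Type*} [CommRing R] {S : Submonoid R} {I : Ideal R}
    (hI : IsSDecomposable S I) :
    ∃ s ∈ S, ∃ (n : ℕ) (p : Fin n → Ideal R),
      (∀ i, (p i).IsPrime ∧ Disjoint (S : Set R) (p i : Set R) ∧ I ≤ p i) ∧
        ∀ x, (∀ i, x ∈ p i) → s * x ∈ I.radical := by
  obtain ⟨n, Q, -, hQ, rfl⟩ := hI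
  choose hne hd s hs hab using hQ
  have mem_p : ∀ i x, x ∈ Submodule.comap (LinearMap.mulLeft R (s i)) (Q i).radical ↔
      s i * x ∈ (Q i).radical := fun i x => Iff.rfl
  have disj : ∀ i, ∀ t ∈ S, t ∉ (Q i).radical := by
    rintro i t ht ⟨k, hk⟩
    exact Set.disjoint_left.1 (hd i) (S.pow_mem ht k) hk
  refine ⟨∏ i, s i, Submonoid.prod_mem _ fun i _ => hs i, n,
    fun i => Submodule.comap (LinearMap.mulLeft R (s i)) (Q i).radical, fun i => ⟨?_, ?_, ?_⟩, ?_⟩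
  · refine ⟨?_, ?_⟩
    · intro htop
      have h1 := (mem_p i 1).1 ((Ideal.eq_top_iff_one _).1 htop)
      rw [mul_one] at h1
      exact disj i _ (hs i) h1
    · intro x y hxy
      obtain ⟨k, hk⟩ := (mem_p i _).1 hxy
      have hk' : (s i ^ k * x ^ k) * y ^ k ∈ Q i := by
        rwa [← mul_pow, ← mul_pow, mul_assoc]
      rcases hab i _ _ hk' with h1 | h1
      · left
        refine (mem_p i x).2 ⟨k + 1, ?_⟩
        have : (s i * x) ^ (k + 1) = x * (s i * (s i ^ k * x ^ k)) := by ring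
        rw [this]
        exact Ideal.mul_mem_left _ _ h1
      · right
        refine (mem_p i y).2 (Ideal.radical_isRadical _ ⟨k + 1, ?_⟩)
        have : (s i * y) ^ (k + 1) = (s i ^ k * y) * (s i * y ^ k) := by ring
        rw [this]
        exact Ideal.mul_mem_left _ _ h1
  · exact Set.disjoint_left.2 fun t ht h1 => disj i _ (S.mul_mem (hs i) ht) ((mem_p i t).1 h1)
  · intro x hx
    exact (mem_p i x).2 (Ideal.le_radical (Ideal.mul_mem_left _ _ ((iInf_le Q i) hx)))
  · intro x hx
    rw [← Finset.inf_univ_eq_iInf]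
    by_cases hn : (Finset.univ : Finset (Fin n)).Nonempty
    · rw [Ideal.radical_eq_sInf, Submodule.mem_sInf]
      rintro q ⟨hq, hqp⟩
      obtain ⟨i, -, hi⟩ := (hqp.inf_le' (s := Finset.univ) (f := Q)).1 hq
      obtain ⟨t, ht⟩ := Finset.dvd_prod_of_mem s (Finset.mem_univ i)
      have h1 := (hqp.radical_le_iff.2 hi) ((mem_p i x).1 (hx i))
      rw [ht, mul_right_comm]
      exact Ideal.mul_mem_right _ _ h1
    · rw [Finset.not_nonempty_iff_eq_empty.1 hn, Finset.inf_empty, Ideal.radical_top]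
      exact Submodule.mem_top

/-- Given a strictly increasing chain of primes `P 0 < P 1 < ⋯` and `x n ∈ P (n + 1) \ P n`, this is
the ideal `P 0 + x 0 P 1 + x 0 x 1 P 2 + ⋯`, truncated after the term of index `n`. -/
def chainIdeal {R : Type*} [CommRing R] (P : ℕ → Ideal R) (x : ℕ → R) : ℕ → Ideal R
  | 0 => P 0
  | n + 1 => chainIdeal P x n ⊔ P (n + 1) * Ideal.span {∏ i ∈ Finset.range (n + 1), x i}

theorem monotone_chainIdeal {R : Type*} [CommRing R] (P : ℕ → Ideal R) (x : ℕ → R) :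
    Monotone (chainIdeal P x) :=
  monotone_nat_of_le_succ fun _ => le_sup_left

theorem mem_of_mul_prod_mem_chainIdeal {R : Type*} [CommRing R] {P : ℕ → Ideal R} {x : ℕ → R}
    (hP : ∀ n, (P n).IsPrime) (hmono : Monotone P) (hx : ∀ n, x n ∉ P n) (n : ℕ) :
    ∀ z, z * ∏ i ∈ Finset.range n, x i ∈ chainIdeal P x n → z ∈ P n := by
  induction n with
  | zero => simp [chainIdeal]
  | succ n ih =>
    intro z hz
    obtain ⟨d, hd, e, he, hde⟩ := Submodule.mem_sup.1 hz
    obtain ⟨p, hp, rfl⟩ := Ideal.mem_mul_span_singleton.1 he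
    have h1 : (z - p) * x n ∈ P n := by
      apply ih
      have : (z - p) * x n * ∏ i ∈ Finset.range n, x i = d := by
        rw [Finset.prod_range_succ] at hde
        linear_combination -hde
      rwa [this]
    have h2 := ((hP n).mem_or_mem h1).resolve_right (hx n)
    simpa using add_mem (hmono n.le_succ h2) hp

theorem mem_of_mul_prod_mem_iSup_chainIdeal {R : Type*} [CommRing R] {P : ℕ → Ideal R} {x : ℕ → R}
    (hP : ∀ n, (P n).IsPrime) (hmono : Monotone P) (hx : ∀ n, x n ∉ P n)
    (hx' : ∀ n, x n ∈ P (n + 1)) (n : ℕ) (z : R)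
    (hz : z * ∏ i ∈ Finset.range n, x i ∈ ⨆ k, chainIdeal P x k) : z ∈ P (n + 1) := by
  have hle : ⨆ k, chainIdeal P x k ≤
      chainIdeal P x n ⊔ P (n + 1) * Ideal.span {∏ i ∈ Finset.range n, x i} := by
    refine iSup_le fun k => ?_
    induction k with
    | zero => exact (monotone_chainIdeal P x n.zero_le).trans le_sup_left
    | succ k ih =>
      rcases lt_or_ge k n with hk | hk
      · exact (monotone_chainIdeal P x hk).trans le_sup_left
      · refine sup_le ih (Ideal.mul_le_right.trans ?_ |>.trans le_sup_right)
        rw [Ideal.span_singleton_le_iff_mem]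
        obtain ⟨t, ht⟩ := Finset.prod_dvd_prod_of_subset _ _ x
          (Finset.range_mono (Nat.succ_le_succ hk))
        rw [ht, Nat.succ_eq_add_one, Finset.prod_range_succ, mul_comm (Finset.prod _ _)]
        exact Ideal.mul_mem_right _ _
          (Ideal.mul_mem_mul (hx' n) (Ideal.mem_span_singleton_self _))
  obtain ⟨d, hd, e, he, hde⟩ := Submodule.mem_sup.1 (hle hz)
  obtain ⟨p, hp, rfl⟩ := Ideal.mem_mul_span_singleton.1 he
  have h1 : z - p ∈ P n := by
    apply mem_of_mul_prod_mem_chainIdeal hP hmono hx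
    have : (z - p) * ∏ i ∈ Finset.range n, x i = d := by linear_combination -hde
    rwa [this]
  simpa using add_mem (hmono n.le_succ h1) hp

/-- A nonnil-`S`-Laskerian ring satisfies the ascending chain condition on primes disjoint
from `S`. -/
theorem NonnilSLaskerian.wellFounded_gt_primes {R : Type*} [CommRing R] {S : Submonoid R}
    (h : NonnilSLaskerian S) :
    WellFounded fun p q : {p : Ideal R // p.IsPrime ∧ Disjoint (S : Set R) (p : Set R)} =>
      q < p := by
  refine RelEmbedding.wellFounded_iff_isEmpty.2 ⟨fun f => ?_⟩
  let P : ℕ → Ideal R := fun n => (f n).1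
  have hP : ∀ n, (P n).IsPrime := fun n => (f n).2.1
  have hS : ∀ n, ∀ t ∈ S, t ∉ P n := fun n t ht => Set.disjoint_left.1 (f n).2.2 ht
  have hlt : ∀ n, P n < P (n + 1) := fun n => f.map_rel_iff.2 (Nat.lt_succ_self n)
  have hmono : Monotone P := monotone_nat_of_le_succ fun n => (hlt n).le
  choose x hx' hx using fun n => SetLike.exists_of_lt (hlt n)
  have key := mem_of_mul_prod_mem_iSup_chainIdeal hP hmono hx hx'
  have hxA : ∀ n, x n * (x n * ∏ i ∈ Finset.range n, x i) ∈ ⨆ k, chainIdeal P x k := by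
    intro n
    refine le_iSup (chainIdeal P x) (n + 1) (Ideal.mem_sup_right ?_)
    rw [mul_comm (x n) (Finset.prod _ _), ← Finset.prod_range_succ]
    exact Ideal.mul_mem_mul (hx' n) (Ideal.mem_span_singleton_self _)
  obtain ⟨m, Q, -, hQ, hA⟩ := h (⨆ k, chainIdeal P x k)
    (fun hnil => hx 0 <| by
      have h1 := nilradical_le_prime (P 0) (hnil (hxA 0))
      simpa [← pow_two, (hP 0).pow_mem_iff_mem] using h1)
    (Set.disjoint_left.2 fun t ht htA => hS 1 t ht (key 0 t (by simpa using htA)))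
  obtain ⟨n, hn⟩ := WellFoundedGT.monotone_chain_condition
    (⟨fun n => {i | Q i ≤ P n}, fun a b hab i hi => le_trans hi (hmono hab)⟩ :
      ℕ →o Set (Fin m))
  have hT : ∀ i, Q i ≤ P n ↔ Q i ≤ P (n + 1) := fun i => Set.ext_iff.1 (hn _ n.le_succ) i
  have hz : ∀ i, ∃ z ∉ P (n + 1), z * ∏ i ∈ Finset.range n, x i ∈ Q i := by
    intro i
    by_cases hi : Q i ≤ P n
    · obtain ⟨-, -, s, hs, hab⟩ := hQ i
      refine ⟨s, hS _ s hs, (hab (∏ i ∈ Finset.range n, x i) (x n * x n) ?_).resolve_right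
        fun h1 => ?_⟩
      · have h1 := hxA n
        rw [hA] at h1
        convert (iInf_le Q i) h1 using 1
        ring
      · have h2 := (hP n).radical_le_iff.2 hi h1
        rcases (hP n).mem_or_mem h2 with h3 | h3
        · exact hS n s hs h3
        · exact hx n (((hP n).mem_or_mem h3).elim id id)
    · obtain ⟨z, hzQ, hz⟩ := SetLike.not_le_iff_exists.1 (mt (hT i).2 hi)
      exact ⟨z, hz, Ideal.mul_mem_right _ _ hzQ⟩
  choose z hz hzQ using hz
  have hprod : ∏ i, z i ∈ P (n + 1) := by
    apply key
    rw [hA, Submodule.mem_iInf]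
    intro i
    obtain ⟨t, ht⟩ := Finset.dvd_prod_of_mem z (Finset.mem_univ i)
    rw [ht, mul_right_comm]
    exact Ideal.mul_mem_right _ _ (hzQ i)
  obtain ⟨i, -, hi⟩ := (hP (n + 1)).prod_mem_iff.1 hprod
  exact hz i hi

/-- If an `S`-decomposable ideal `I` is such that every prime `q ⊇ I` disjoint from `S`
admits a finitely generated ideal `K ≤ P` such that `P` lies in every prime over
`q ⊔ K` disjoint from `S`, then so does `I`. -/
theorem IsSDecomposable.exists_fg_le {R : Type*} [CommRing R] {S : Submonoid R} {I P : Ideal R}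
    (hI : IsSDecomposable S I)
    (H : ∀ q : Ideal R, q.IsPrime → Disjoint (S : Set R) (q : Set R) → I ≤ q →
      ∃ K : Ideal R, K.FG ∧ K ≤ P ∧ ∀ q' : Ideal R, q'.IsPrime →
        Disjoint (S : Set R) (q' : Set R) → q ≤ q' → K ≤ q' → P ≤ q') :
    ∃ K : Ideal R, K.FG ∧ K ≤ P ∧ ∀ q' : Ideal R, q'.IsPrime →
      Disjoint (S : Set R) (q' : Set R) → I ≤ q' → K ≤ q' → P ≤ q' := by
  obtain ⟨s, hs, n, p, hp, hsp⟩ := hI.exists_primes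
  choose K hfg hKP hK using fun i => H (p i) (hp i).1 (hp i).2.1 (hp i).2.2
  refine ⟨⨆ i, K i, Submodule.fg_iSup _ hfg, iSup_le hKP, fun q' hq' hd hIq hKq => ?_⟩
  obtain ⟨i, hi⟩ : ∃ i, p i ≤ q' := by
    by_contra! hcon
    choose w hwp hw using fun i => SetLike.not_le_iff_exists.1 (hcon i)
    have h1 : s * ∏ i, w i ∈ q' := by
      refine hq'.radical_le_iff.2 hIq (hsp _ fun i => ?_)
      exact Ideal.mem_of_dvd _ (Finset.dvd_prod_of_mem w (Finset.mem_univ i)) (hwp i)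
    rcases hq'.mem_or_mem h1 with h2 | h2
    · exact Set.disjoint_left.1 hd hs h2
    · obtain ⟨i, -, hi⟩ := hq'.prod_mem_iff.1 h2
      exact hw i hi
  exact hK i q' hq' hd hi ((le_iSup K i).trans hKq)

/-- If `R` is nonnil-`S`-Laskerian with `S`-decomposable nilradical, then every prime
ideal of `R` is radically `S`-finite, i.e. `R` has `S`-Noetherian spectrum. -/
theorem nonnilSLaskerian_SNoetherianSpectrum {R : Type*} [CommRing R] (S : Submonoid R)
    (h : NonnilSLaskerian S) (hnil : IsSDecomposable S (nilradical R)) :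
    ∀ P : Ideal R, P.IsPrime →
      ∃ s ∈ S, ∃ J : Ideal R, J.FG ∧ (∀ x ∈ P, s * x ∈ J.radical) ∧
        J.radical ≤ P.radical := by
  intro P hP
  by_cases hPS : Disjoint (S : Set R) (P : Set R)
  swap
  · obtain ⟨s, hs, hsP⟩ := Set.not_disjoint_iff.1 hPS
    exact ⟨s, hs, Ideal.span {s}, ⟨{s}, by simp⟩,
      fun x _ => Ideal.le_radical
        (Ideal.mul_mem_right _ _ (Ideal.mem_span_singleton_self s)),
      Ideal.radical_mono ((Ideal.span_singleton_le_iff_mem _).2 hsP)⟩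
  have E : ∀ q : {p : Ideal R // p.IsPrime ∧ Disjoint (S : Set R) (p : Set R)},
      ∃ K : Ideal R, K.FG ∧ K ≤ P ∧ ∀ q' : Ideal R, q'.IsPrime →
        Disjoint (S : Set R) (q' : Set R) → q.1 ≤ q' → K ≤ q' → P ≤ q' := by
    intro q
    induction q using h.wellFounded_gt_primes.induction with
    | _ q ih =>
    obtain ⟨q, hq, hqS⟩ := q
    by_cases hPq : P ≤ q
    · exact ⟨⊥, Submodule.fg_bot, bot_le, fun q' _ _ hle _ => hPq.trans hle⟩
    obtain ⟨x, hxP, hxq⟩ := SetLike.not_le_iff_exists.1 hPq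
    have hxP' : Ideal.span {x} ≤ P := (Ideal.span_singleton_le_iff_mem _).2 hxP
    have hxmem : x ∈ q ⊔ Ideal.span {x} :=
      Ideal.mem_sup_right (Ideal.mem_span_singleton_self x)
    by_cases hd : Disjoint (S : Set R) ((q ⊔ Ideal.span {x} : Ideal R) : Set R)
    · obtain ⟨K, hfg, hKP, hK⟩ := (h (q ⊔ Ideal.span {x})
        (fun hle => hxq (nilradical_le_prime q (hle hxmem))) hd).exists_fg_le (P := P)
        (fun p hp hpS hle => ih ⟨p, hp, hpS⟩
          (lt_of_le_of_ne (le_sup_left.trans hle)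
            fun he => hxq ((Subtype.ext_iff.1 he).ge (hle hxmem))))
      refine ⟨Ideal.span {x} ⊔ K, Submodule.FG.sup ⟨{x}, by simp⟩ hfg, sup_le hxP' hKP,
        fun q' hq' hd' hle hKq => hK q' hq' hd' (sup_le hle (le_sup_left.trans hKq))
          (le_sup_right.trans hKq)⟩
    · refine ⟨Ideal.span {x}, ⟨{x}, by simp⟩, hxP', fun q' _ hd' hle hKq => ?_⟩
      exact absurd (hd'.mono_right (SetLike.coe_subset_coe.2 (sup_le hle hKq))) hd
  obtain ⟨K, hfg, hKP, hK⟩ := hnil.exists_fg_le (P := P) fun q hq hqS _ => E ⟨q, hq, hqS⟩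
  have uniform : ∀ I : Ideal R, IsSDecomposable S I → K ≤ I →
      ∃ s ∈ S, ∀ x ∈ P, s * x ∈ I.radical := by
    intro I hI hKI
    obtain ⟨s, hs, n, p, hp, hsp⟩ := hI.exists_primes
    refine ⟨s, hs, fun x hx => hsp x fun i => ?_⟩
    obtain ⟨hpi, hpS, hIp⟩ := hp i
    exact hK (p i) hpi hpS (nilradical_le_prime _) (hKI.trans hIp) hx
  by_cases hKnil : K ≤ nilradical R
  · obtain ⟨s, hs, hsP⟩ := uniform _ hnil hKnil
    refine ⟨s, hs, ⊥, Submodule.fg_bot, fun x hx => ?_, Ideal.radical_mono bot_le⟩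
    exact Ideal.radical_isRadical _ (hsP x hx)
  · obtain ⟨s, hs, hsP⟩ := uniform K (h K hKnil
      (hPS.mono_right (SetLike.coe_subset_coe.2 hKP))) le_rfl
    exact ⟨s, hs, K, hfg, hsP, Ideal.radical_mono hKP⟩
end

section
/- Let R be a commutative ring with identity and S a multiplicatively closed subset of R. Then R is nonnil-S-Noetherian if and only if every nonempty S-saturated set of nonnil ideals of R has a maximal element with respect to inclusion. -/
variable {R : Type*}

theorem Ideal.FG.exists_le_of_le_sSup_chain {R : Type*} [CommRing R] {J : Ideal R} (hJ : J.FG)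
    {c : Set (Ideal R)} (hc : IsChain (· ≤ ·) c) (hne : c.Nonempty) (h : J ≤ sSup c) :
    ∃ L ∈ c, J ≤ L :=
  (CompleteLattice.isCompactElement_iff_le_of_directed_sSup_le _ _).1
    ((Submodule.fg_iff_compact J).1 hJ) c hne hc.directedOn h

/-- `R` is nonnil-`S`-Noetherian iff every nonempty `S`-saturated set of nonnil
ideals of `R` has a maximal element with respect to inclusion. -/
theorem nonnilSNoetherian_iff_saturated_max {R : Type*} [CommRing R]
    (S : Submonoid R) :
    NonnilSNoetherian S ↔
      ∀ F : Set (Ideal R), F.Nonempty → (∀ J ∈ F, ¬ J ≤ nilradical R) →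
        (∀ I : Ideal R, ¬ I ≤ nilradical R →
          (∃ s ∈ S, ∃ J ∈ F, ∀ x ∈ I, s * x ∈ J) → I ∈ F) →
        ∃ M ∈ F, ∀ J ∈ F, ¬ M < J := by
  constructor
  · intro hN F ⟨I₀, hI₀⟩ hF hsat
    have hub : ∀ c ⊆ F, IsChain (· ≤ ·) c → ∀ L ∈ c, ∃ U ∈ F, ∀ K ∈ c, K ≤ U := by
      intro c hcF hc L hL
      have hnil : ¬ sSup c ≤ nilradical R := fun h => hF L (hcF hL) ((le_sSup hL).trans h)
      obtain ⟨s, hs, J, hJ, hJle, hsJ⟩ := hN _ hnil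
      obtain ⟨K, hK, hJK⟩ := hJ.exists_le_of_le_sSup_chain hc ⟨L, hL⟩ hJle
      exact ⟨sSup c, hsat _ hnil ⟨s, hs, K, hcF hK, fun x hx => hJK (hsJ x hx)⟩,
        fun _ => le_sSup⟩
    obtain ⟨M, -, hM⟩ := zorn_le_nonempty₀ F hub I₀ hI₀
    exact ⟨M, hM.prop, fun J hJ => hM.not_gt hJ⟩
  · intro h I hI
    obtain ⟨a, haI, ha⟩ := SetLike.not_le_iff_exists.1 hI
    obtain ⟨M, ⟨hMnil, s, hs, J, hJ, hJI, hsJ⟩, hmax⟩ := h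
      {L | ¬ L ≤ nilradical R ∧ ∃ s ∈ S, ∃ J : Ideal R, J.FG ∧ J ≤ I ∧ ∀ x ∈ L, s * x ∈ J}
      ⟨Ideal.span {a}, fun hle => ha (hle (Ideal.mem_span_singleton_self a)), 1, S.one_mem,
        Ideal.span {a}, Submodule.fg_span_singleton a,
        (Ideal.span_singleton_le_iff_mem I).2 haI, fun x hx => by rwa [one_mul]⟩
      (fun _ hL => hL.1)
      (by
        rintro L hL ⟨t, ht, K, ⟨-, s, hs, J, hJ, hJI, hsJ⟩, htK⟩
        exact ⟨hL, s * t, S.mul_mem hs ht, J, hJ, hJI, fun x hx => by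
          rw [mul_assoc]; exact hsJ _ (htK x hx)⟩)
    refine ⟨s, hs, J, hJ, hJI, fun x hx => hsJ x ?_⟩
    by_contra hxM
    refine hmax (M ⊔ Ideal.span {x})
      ⟨fun hle => hMnil (le_sup_left.trans hle), s, hs, J ⊔ Ideal.span {x},
        Submodule.FG.sup hJ (Submodule.fg_span_singleton x),
        sup_le hJI ((Ideal.span_singleton_le_iff_mem I).2 hx), fun y hy => ?_⟩
      (lt_of_le_of_ne le_sup_left fun heq => hxM ?_)
    · obtain ⟨m, hm, z, hz, rfl⟩ := Submodule.mem_sup.1 hy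
      rw [mul_add]
      exact add_mem (Ideal.mem_sup_left (hsJ m hm))
        (Ideal.mem_sup_right (Ideal.mul_mem_left _ s hz))
    · rw [heq]
      exact Ideal.mem_sup_right (Ideal.mem_span_singleton_self x)
end

section
/- Let R be a commutative ring with identity and S a multiplicatively closed subset of R. Then R is nonnil-S-Noetherian if and only if every nonempty set E of nonnil ideals of R has an S-maximal element with respect to inclusion, i.e., there exist I ∈ E and s ∈ S such that for every J ∈ E with I ⊆ J one has sJ ⊆ I. -/
variable {R : Type*}

/-- The `S`-saturation of `I`: the elements that some `s ∈ S` multiplies into `I`. -/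
def Ideal.saturationAt [CommRing R] (S : Submonoid R) (I : Ideal R) : Ideal R where
  carrier := {x | ∃ s ∈ S, s * x ∈ I}
  zero_mem' := ⟨1, S.one_mem, by simp⟩
  add_mem' := by
    rintro x y ⟨s, hs, hx⟩ ⟨t, ht, hy⟩
    refine ⟨s * t, S.mul_mem hs ht, ?_⟩
    have h : s * t * (x + y) = t * (s * x) + s * (t * y) := by ring
    rw [h]
    exact I.add_mem (I.mul_mem_left _ hx) (I.mul_mem_left _ hy)
  smul_mem' := by
    rintro r x ⟨s, hs, hx⟩
    refine ⟨s, hs, ?_⟩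
    rw [smul_eq_mul, mul_left_comm]
    exact I.mul_mem_left _ hx

namespace Ideal

variable [CommRing R] {S : Submonoid R} {I J : Ideal R}

theorem le_saturationAt : I ≤ I.saturationAt S := fun _ hx =>
  ⟨1, S.one_mem, by simpa using hx⟩

theorem saturationAt_mono (h : I ≤ J) : I.saturationAt S ≤ J.saturationAt S :=
  fun _ ⟨s, hs, hx⟩ => ⟨s, hs, h hx⟩

theorem mem_saturationAt_of_mul_mem {s x : R} (hs : s ∈ S) (h : s * x ∈ I.saturationAt S) :
    x ∈ I.saturationAt S := by
  obtain ⟨t, ht, hx⟩ := h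
  exact ⟨t * s, S.mul_mem ht hs, by rwa [mul_assoc]⟩

theorem exists_mul_mem_of_fg_le_saturationAt (hJ : J.FG) (h : J ≤ I.saturationAt S) :
    ∃ s ∈ S, ∀ x ∈ J, s * x ∈ I := by
  classical
  obtain ⟨T, rfl⟩ := hJ
  choose! f hfS hfI using fun x (hx : x ∈ T) => h (subset_span hx)
  refine ⟨∏ x ∈ T, f x, S.prod_mem hfS, fun x hx => ?_⟩
  induction hx using Submodule.span_induction with
  | mem x hx =>
    rw [← Finset.prod_erase_mul T f hx, mul_assoc]
    exact I.mul_mem_left _ (hfI x hx)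
  | zero => simp
  | add x y _ _ hx hy =>
    rw [mul_add]
    exact I.add_mem hx hy
  | smul r x _ hx =>
    rw [smul_eq_mul, mul_left_comm]
    exact I.mul_mem_left _ hx

theorem exists_le_of_fg_le_iSup {C : ℕ → Ideal R} (hC : Monotone C) (hJ : J.FG)
    (h : J ≤ ⨆ n, C n) : ∃ n, J ≤ C n := by
  obtain ⟨T, rfl⟩ := hJ
  have hT : (T : Set R) ⊆ ⋃ n, (C n : Set R) := by
    rw [← Submodule.coe_iSup_of_directed C hC.directed_le]
    exact subset_span.trans h
  obtain ⟨n, hn⟩ := Directed.exists_mem_subset_of_finset_subset_biUnion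
    (f := fun n => (C n : Set R)) hC.directed_le hT
  exact ⟨n, span_le.2 hn⟩

end Ideal

/-- Saturations of nonnil ideals satisfy the maximal condition. -/
theorem NonnilSNoetherian.exists_maximal_saturationAt [CommRing R] {S : Submonoid R}
    (h : NonnilSNoetherian S) {E : Set (Ideal R)} (hne : E.Nonempty)
    (hE : ∀ J ∈ E, ¬ J ≤ nilradical R) :
    ∃ I ∈ E, ∀ J ∈ E, I.saturationAt S ≤ J.saturationAt S →
      J.saturationAt S ≤ I.saturationAt S := by
  by_contra! hmax
  let A := Ideal.saturationAt S '' E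
  have : Nonempty A := (hne.image _).to_subtype
  have : NoMaxOrder A := by
    refine ⟨?_⟩
    rintro ⟨_, I, hI, rfl⟩
    obtain ⟨J, hJ, hIJ, hJI⟩ := hmax I hI
    exact ⟨⟨_, J, hJ, rfl⟩, lt_of_le_not_ge hIJ hJI⟩
  obtain ⟨f, hf⟩ := Nat.exists_strictMono A
  have hC : Monotone fun n => (f n : Ideal R) := fun _ _ hmn => hf.monotone hmn
  have hU : ¬ (⨆ n, (f n : Ideal R)) ≤ nilradical R := fun hle => by
    obtain ⟨I, hI, hIf⟩ := (f 0).2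
    refine hE I hI (Ideal.le_saturationAt.trans (hIf.le.trans ?_))
    exact (le_iSup (fun n => (f n : Ideal R)) 0).trans hle
  obtain ⟨s, hs, F, hF, hFU, hsF⟩ := h _ hU
  obtain ⟨n, hn⟩ := Ideal.exists_le_of_fg_le_iSup hC hF hFU
  refine (hf n.lt_succ_self).not_ge fun x hx => ?_
  have hsx := hn (hsF x (le_iSup (fun n => (f n : Ideal R)) (n + 1) hx))
  obtain ⟨I, -, hIf⟩ := (f n).2
  rw [← hIf] at hsx ⊢
  exact Ideal.mem_saturationAt_of_mul_mem hs hsx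

/-- `R` is nonnil-`S`-Noetherian iff every nonempty set of nonnil ideals of `R` has
an `S`-maximal element with respect to inclusion. -/
theorem nonnilSNoetherian_iff_SMaximal {R : Type*} [CommRing R] (S : Submonoid R) :
    NonnilSNoetherian S ↔
      ∀ E : Set (Ideal R), E.Nonempty → (∀ J ∈ E, ¬ J ≤ nilradical R) →
        ∃ I ∈ E, ∃ s ∈ S, ∀ J ∈ E, I ≤ J → ∀ x ∈ J, s * x ∈ I := by
  constructor
  · intro h E hne hE
    obtain ⟨I, hI, hmax⟩ := h.exists_maximal_saturationAt hne hE
    obtain ⟨s, hs, F, hF, hFI, hsF⟩ :=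
      h (I.saturationAt S) fun hle => hE I hI (Ideal.le_saturationAt.trans hle)
    obtain ⟨t, ht, htF⟩ := Ideal.exists_mul_mem_of_fg_le_saturationAt hF hFI
    refine ⟨I, hI, t * s, S.mul_mem ht hs, fun J hJ hIJ x hx => ?_⟩
    rw [mul_assoc]
    exact htF _ (hsF x (hmax J hJ (Ideal.saturationAt_mono hIJ) (Ideal.le_saturationAt hx)))
  · intro h I hI
    obtain ⟨a, haI, ha⟩ := SetLike.not_le_iff_exists.1 hI
    obtain ⟨J, ⟨hJ, hJI, hJnil⟩, s, hs, hmax⟩ :=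
      h {J | J.FG ∧ J ≤ I ∧ ¬ J ≤ nilradical R}
        ⟨Ideal.span {a}, ⟨{a}, by simp⟩, by simpa [Ideal.span_le] using haI,
          fun hle => ha (hle (Ideal.mem_span_singleton_self a))⟩
        fun J hJ => hJ.2.2
    refine ⟨s, hs, J, hJ, hJI, fun x hx => ?_⟩
    refine hmax (J ⊔ Ideal.span {x})
      ⟨Submodule.FG.sup hJ ⟨{x}, by simp⟩, sup_le hJI (by simpa [Ideal.span_le] using hx),
        fun hle => hJnil (le_sup_left.trans hle)⟩ le_sup_left x ?_
    exact Ideal.mem_sup_right (Ideal.mem_span_singleton_self x)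
end

section
/- Let R be a nonnil-S-Noetherian commutative ring with identity, where S is a multiplicatively closed subset of R. Then every nonnil S-irreducible ideal of R is S-primary. -/
variable {R : Type*}

/-- An ideal `Q` disjoint from `S` is `S`-irreducible if whenever
`s(I ∩ J) ⊆ Q ⊆ I ∩ J` for some `s ∈ S` and ideals `I`, `J`, there is `s' ∈ S`
such that `s s' I ⊆ Q` or `s s' J ⊆ Q`. -/
def IsSIrreducible [CommRing R] (S : Submonoid R) (Q : Ideal R) : Prop :=
  Disjoint (S : Set R) (Q : Set R) ∧
    ∀ s ∈ S, ∀ I J : Ideal R, (∀ x ∈ I ⊓ J, s * x ∈ Q) → Q ≤ I ⊓ J →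
      ∃ s' ∈ S, (∀ x ∈ I, s * s' * x ∈ Q) ∨ (∀ x ∈ J, s * s' * x ∈ Q)

/-- The `T`-saturation of an ideal `I`: the elements `x` with `t * x ∈ I` for some `t ∈ T`. -/
def Ideal.saturationBy [CommRing R] (T : Submonoid R) (I : Ideal R) : Ideal R where
  carrier := {x | ∃ t ∈ T, t * x ∈ I}
  zero_mem' := ⟨1, T.one_mem, by simp⟩
  add_mem' := by
    rintro x y ⟨t, ht, hx⟩ ⟨u, hu, hy⟩
    refine ⟨t * u, T.mul_mem ht hu, ?_⟩
    have h := I.add_mem (I.mul_mem_left u hx) (I.mul_mem_left t hy)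
    convert h using 1
    ring
  smul_mem' := by
    rintro c x ⟨t, ht, hx⟩
    refine ⟨t, ht, ?_⟩
    have h := I.mul_mem_left c hx
    convert h using 1
    rw [smul_eq_mul]
    ring

theorem Ideal.le_saturationBy [CommRing R] (T : Submonoid R) (I : Ideal R) :
    I ≤ I.saturationBy T :=
  fun x hx => ⟨1, T.one_mem, by simpa using hx⟩

/-- A finitely generated ideal inside the `T`-saturation of `I` is multiplied into `I` by a
single element of `T`. -/
theorem Ideal.FG.exists_forall_mul_mem [CommRing R] {T : Submonoid R} {I J : Ideal R}
    (hJ : J.FG) (h : J ≤ I.saturationBy T) : ∃ t ∈ T, ∀ x ∈ J, t * x ∈ I := by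
  induction J, hJ using Submodule.fg_induction with
  | singleton a =>
    obtain ⟨t, ht, hta⟩ := h (Submodule.mem_span_singleton_self a)
    refine ⟨t, ht, fun x hx => ?_⟩
    obtain ⟨c, rfl⟩ := Submodule.mem_span_singleton.mp hx
    rw [smul_eq_mul, mul_left_comm]
    exact I.mul_mem_left c hta
  | sup J₁ J₂ _ _ ih₁ ih₂ =>
    obtain ⟨t, ht, h₁⟩ := ih₁ (le_sup_left.trans h)
    obtain ⟨u, hu, h₂⟩ := ih₂ (le_sup_right.trans h)
    refine ⟨t * u, T.mul_mem ht hu, fun x hx => ?_⟩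
    obtain ⟨y, hy, z, hz, rfl⟩ := Submodule.mem_sup.mp hx
    have h := I.add_mem (I.mul_mem_left u (h₁ y hy)) (I.mul_mem_left t (h₂ z hz))
    convert h using 1
    ring

/-- In a nonnil-`S`-Noetherian ring, the `T`-saturation of a nonnil ideal `I` is multiplied
into `I` by the product of an element of `T` and an element of `S`. -/
theorem NonnilSNoetherian.exists_forall_mul_mem [CommRing R] {S : Submonoid R}
    (hR : NonnilSNoetherian S) (T : Submonoid R) {I : Ideal R} (hI : ¬ I ≤ nilradical R) :
    ∃ t ∈ T, ∃ s ∈ S, ∀ x ∈ I.saturationBy T, t * (s * x) ∈ I := by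
  obtain ⟨s, hs, J, hJ, hJI, hsJ⟩ :=
    hR (I.saturationBy T) fun h => hI ((I.le_saturationBy T).trans h)
  obtain ⟨t, ht, htJ⟩ := hJ.exists_forall_mul_mem hJI
  exact ⟨t, ht, s, hs, fun x hx => htJ _ (hsJ x hx)⟩

/-- The elementwise form of the theorem below, with the multiplier depending on `a` and `b`. -/
theorem IsSIrreducible.mem_saturationBy_or [CommRing R] {S : Submonoid R}
    (hR : NonnilSNoetherian S) {Q : Ideal R} (hQ : ¬ Q ≤ nilradical R)
    (hirr : IsSIrreducible S Q) {a b : R} (hab : a * b ∈ Q) :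
    a ∈ Q.saturationBy S ∨ b ∈ Q.radical.saturationBy S := by
  obtain ⟨_, ⟨n, rfl⟩, s, hs, hsat⟩ := hR.exists_forall_mul_mem (Submonoid.powers b) hQ
  have hmem : ∀ x ∈ (Q ⊔ Ideal.span {a}) ⊓ (Q ⊔ Ideal.span {b ^ n}), s * x ∈ Q := by
    rintro x ⟨hxa, hxb⟩
    obtain ⟨q, hq, _, hy, rfl⟩ := Submodule.mem_sup.mp hxb
    obtain ⟨r, rfl⟩ := Ideal.mem_span_singleton'.mp hy
    obtain ⟨q', hq', _, hz, he⟩ := Submodule.mem_sup.mp hxa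
    obtain ⟨t, rfl⟩ := Ideal.mem_span_singleton'.mp hz
    have hbr : b ^ (n + 1) * r ∈ Q := by
      have h := Q.sub_mem (Q.add_mem (Q.mul_mem_left b hq') (Q.mul_mem_left t hab))
        (Q.mul_mem_left b hq)
      convert h using 1
      linear_combination -b * he
    have hr := hsat r ⟨b ^ (n + 1), ⟨n + 1, rfl⟩, hbr⟩
    have h := Q.add_mem (Q.mul_mem_left s hq) hr
    convert h using 1
    ring
  obtain ⟨s', hs', h | h⟩ := hirr.2 s hs _ _ hmem (le_inf le_sup_left le_sup_left)
  · exact .inl ⟨s * s', S.mul_mem hs hs',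
      h a (Ideal.mem_sup_right (Ideal.mem_span_singleton_self a))⟩
  · refine .inr ⟨s * s', S.mul_mem hs hs', n + 1, ?_⟩
    have hb := h _ (Ideal.mem_sup_right (Ideal.mem_span_singleton_self (b ^ n)))
    have h := Q.mul_mem_left ((s * s') ^ n * b) hb
    convert h using 1
    ring

/-- In a nonnil-`S`-Noetherian ring, every nonnil `S`-irreducible ideal is
`S`-primary. -/
theorem SIrreducible_SPrimary {R : Type*} [CommRing R] (S : Submonoid R)
    (hR : NonnilSNoetherian S) (Q : Ideal R) (hQ : ¬ Q ≤ nilradical R)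
    (hirr : IsSIrreducible S Q) : IsSPrimary S Q := by
  refine ⟨?_, hirr.1, ?_⟩
  · rintro rfl
    exact Set.disjoint_left.mp hirr.1 S.one_mem Submodule.mem_top
  obtain ⟨t, ht, u, hu, hsatQ⟩ := hR.exists_forall_mul_mem S hQ
  obtain ⟨v, hv, w, hw, hsatRad⟩ :=
    hR.exists_forall_mul_mem S fun h => hQ (Ideal.le_radical.trans h)
  refine ⟨(t * u) * (v * w), S.mul_mem (S.mul_mem ht hu) (S.mul_mem hv hw),
    fun a b hab => ?_⟩
  refine (hirr.mem_saturationBy_or hR hQ hab).imp (fun ha => ?_) fun hb => ?_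
  · have h := Q.mul_mem_left (v * w) (hsatQ a ha)
    convert h using 1
    ring
  · have h := Q.radical.mul_mem_left (t * u) (hsatRad b hb)
    convert h using 1
    ring
end
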